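/- Let X be a Banach space, f : X → ℝ ∪ {+∞} convex lower semicontinuous, x̄ ∈ [f ≤ 0] and q ∈ (0,1] (with the convention 0⁰ = 1). If liminf over x → x̄ with f(x) > 0, f(x) → 0, of q · f(x)^{q−1} · d(0, ∂f(x)) is at least τ > 0, then liminf over x → x̄ with f(x) > 0, f(x) → 0, of q^q (1−q)^{1−q} · d(x, [f ≤ 0])^{q−1} · d(0, ∂f(x))^q is at least (1−q)^{1−q} τ; i.e., (1−q)^{1−q} · Er̲_q f(x̄) ≤ Er̲′_q f(x̄) where Er̲_q f(x̄) := q liminf_{x→x̄, f(x)↓0} d(0,∂f(x))/f(x)^{1−q} and Er̲′_q f(x̄) := q^q(1−q)^{1−q} liminf_{x→x̄, f(x)↓0} d(0,∂f(x))^q / d(x,[f≤0])^{1−q}. -/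

import Mathlib

open EMetric ENNReal

/-- Convexity for an `EReal`-valued function (modelling `f : X → ℝ ∪ {+∞}`). -/
def EConvexOn {X : Type*} [NormedAddCommGroup X] [NormedSpace ℝ X]
    (f : X → EReal) : Prop :=
  ∀ u v : X, ∀ t : ℝ, 0 ≤ t → t ≤ 1 →
    f (t • u + (1 - t) • v) ≤ (t : EReal) * f u + ((1 - t : ℝ) : EReal) * f v

/-- The (convex) subdifferential of `f` at `x`. -/
def ESubdiff {X : Type*} [NormedAddCommGroup X] [NormedSpace ℝ X]
    (f : X → EReal) (x : X) : Set (X →L[ℝ] ℝ) :=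
  {g | ∀ u : X, ((g (u - x) : ℝ) : EReal) ≤ f u - f x}

/-- The "positive part" of an extended real, as an element of `[0, +∞]`. -/
noncomputable def EReal.toENN (a : EReal) : ℝ≥0∞ :=
  if a = ⊤ then ⊤ else ENNReal.ofReal a.toReal

/-- `d(0, ∂f(x)) = inf {‖x*‖ : x* ∈ ∂f(x)}`, `+∞` if `∂f(x) = ∅`. -/
noncomputable def dSub {X : Type*} [NormedAddCommGroup X] [NormedSpace ℝ X]
    (f : X → EReal) (x : X) : ℝ≥0∞ :=
  ⨅ g ∈ ESubdiff f x, ENNReal.ofReal ‖g‖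

open Filter Topology in
/-- Ekeland's variational principle. -/
theorem ekeland_aux {X : Type*} [MetricSpace X] [CompleteSpace X]
    (F : X → ℝ≥0∞) (hF : LowerSemicontinuous F) (A : ℝ≥0∞) (hA0 : A ≠ 0) (hA : A ≠ ⊤)
    (x : X) (hx : F x ≠ ⊤) :
    ∃ y, F y + A * edist x y ≤ F x ∧ ∀ z, F z + A * edist y z ≤ F y → z = y := by
  let S : X → Set X := fun u => {z | F z + A * edist u z ≤ F u}
  have hself : ∀ u, u ∈ S u := fun u => by simp [S]
  have htrans : ∀ u v w, v ∈ S u → w ∈ S v → w ∈ S u := by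
    intro u v w hv hw
    simp only [S, Set.mem_ofPred_eq] at *
    calc F w + A * edist u w ≤ F w + A * (edist u v + edist v w) := by
          gcongr; exact edist_triangle _ _ _
      _ = (F w + A * edist v w) + A * edist u v := by ring
      _ ≤ F v + A * edist u v := by gcongr
      _ ≤ F u := hv
  have hclosed : ∀ u, IsClosed (S u) := by
    intro u
    have : LowerSemicontinuous fun z => F z + A * edist u z := by
      apply hF.add
      apply Continuous.lowerSemicontinuous
      exact (ENNReal.continuous_const_mul hA).comp (continuous_const.edist continuous_id)
    exact this.isClosed_preimage (F u)
  have hstep : ∀ (n : ℕ) (u : X), ∃ v, F u ≠ ⊤ → (v ∈ S u ∧ ∀ z ∈ S u, F v ≤ F z + 2⁻¹ ^ n) := by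
    intro n u
    by_cases hu : F u = ⊤
    · exact ⟨u, fun h => absurd hu h⟩
    have hne : (⨅ z ∈ S u, F z) ≠ ⊤ :=
      ne_top_of_le_ne_top hu (iInf₂_le u (hself u))
    have hlt : (⨅ z ∈ S u, F z) < (⨅ z ∈ S u, F z) + 2⁻¹ ^ n :=
      ENNReal.lt_add_right hne (by simp)
    obtain ⟨v, hv, hv2⟩ : ∃ v, ∃ _ : v ∈ S u, F v < (⨅ z ∈ S u, F z) + 2⁻¹ ^ n := by
      simpa only [iInf_lt_iff] using hlt
    refine ⟨v, fun _ => ⟨hv, fun z hz => hv2.le.trans ?_⟩⟩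
    gcongr
    exact iInf₂_le z hz
  choose nxt hnxt using hstep
  let s : ℕ → X := fun n => Nat.rec x (fun n u => nxt n u) n
  have hs0 : s 0 = x := rfl
  have hsS : ∀ n, s (n + 1) = nxt n (s n) := fun n => rfl
  have hfin : ∀ n, F (s n) ≠ ⊤ := by
    intro n
    induction n with
    | zero => exact hx
    | succ n ih =>
      have := (hnxt n (s n) ih).1
      rw [← hsS] at this
      exact ne_top_of_le_ne_top ih (le_self_add.trans this)
  have hmem : ∀ n, s (n + 1) ∈ S (s n) := fun n => (hnxt n (s n) (hfin n)).1
  have hmono : ∀ n m, n ≤ m → s m ∈ S (s n) := by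
    intro n m h
    induction m, h using Nat.le_induction with
    | base => exact hself _
    | succ m _ ih => exact htrans _ _ _ ih (hmem m)
  have hsmall : ∀ n, ∀ z ∈ S (s (n + 1)), edist (s (n + 1)) z ≤ 2⁻¹ ^ n / A := by
    intro n z hz
    have h1 := (hnxt n (s n) (hfin n)).2 z (htrans _ _ _ (hmem n) hz)
    rw [← hsS] at h1
    have h2 : F z + A * edist (s (n + 1)) z ≤ F (s (n + 1)) := hz
    have h3 : F z ≠ ⊤ := ne_top_of_le_ne_top (hfin (n + 1)) (le_self_add.trans h2)
    have h4 := (ENNReal.add_le_add_iff_left h3).1 (h2.trans h1)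
    rw [ENNReal.le_div_iff_mul_le (Or.inl hA0) (Or.inl hA), mul_comm]
    exact h4
  have hlim : Tendsto (fun n : ℕ => (2⁻¹ : ℝ≥0∞) ^ n / A) atTop (𝓝 0) := by
    have := ENNReal.Tendsto.div_const (b := A)
      (ENNReal.tendsto_pow_atTop_nhds_zero_of_lt_one (r := 2⁻¹) (by simp)) (Or.inr hA0)
    simpa using this
  have hcau : CauchySeq (fun n => s (n + 1)) := by
    rw [EMetric.cauchySeq_iff_NNReal]
    intro ε hε
    have hev : ∀ᶠ n in atTop, (2⁻¹ : ℝ≥0∞) ^ n / A < ε :=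
      hlim.eventually_lt_const (by simpa using hε)
    obtain ⟨N, hN⟩ := hev.exists
    refine ⟨N, fun n hn => ?_⟩
    rw [edist_comm]
    exact (hsmall N _ (hmono (N + 1) (n + 1) (by omega))).trans_lt hN
  obtain ⟨y, hy⟩ := cauchySeq_tendsto_of_complete hcau
  have hyS : ∀ n, y ∈ S (s n) := by
    intro n
    refine (hclosed _).mem_of_tendsto hy ?_
    filter_upwards [eventually_ge_atTop n] with m hm
    exact hmono n (m + 1) (by omega)
  refine ⟨y, hyS 0, fun z hz => ?_⟩
  have hz' : Tendsto (fun n => s (n + 1)) atTop (𝓝 z) := by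
    rw [tendsto_iff_edist_tendsto_0]
    exact tendsto_of_tendsto_of_tendsto_of_le_of_le tendsto_const_nhds hlim (fun _ => zero_le)
      (fun n => hsmall n z (htrans _ _ _ (hyS (n + 1)) hz))
  exact tendsto_nhds_unique hz' hy

/-- Tangent inequality for the concave power. -/
theorem rpow_tangent_aux {a b q : ℝ} (ha : 0 < a) (hb : 0 ≤ b) (hq0 : 0 ≤ q) (hq1 : q ≤ 1) :
    b ^ q ≤ a ^ q + q * a ^ (q - 1) * (b - a) := by
  have h := rpow_one_add_le_one_add_mul_self (s := b / a - 1) (by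
    have : 0 ≤ b / a := by positivity
    linarith) hq0 hq1
  have h1 : (1 + (b / a - 1)) = b / a := by ring
  rw [h1, Real.div_rpow hb ha.le, div_le_iff₀ (by positivity)] at h
  rw [Real.rpow_sub_one ha.ne']
  refine h.trans (le_of_eq ?_)
  field_simp

theorem local_to_global_aux {X : Type*} [NormedAddCommGroup X] [NormedSpace ℝ X]
    (f : X → EReal) (hbot : ∀ u, f u ≠ ⊥) (hconv : EConvexOn f) (y : X) (c β : ℝ)
    (hc : f y = c) (hloc : ∀ᶠ z in nhds y, ((c - β * ‖z - y‖ : ℝ) : EReal) ≤ f z) (z : X) :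
    ((c - β * ‖z - y‖ : ℝ) : EReal) ≤ f z := by
  by_cases htop : f z = ⊤
  · simp [htop]
  obtain ⟨r, hr⟩ : ∃ r : ℝ, f z = r := ⟨(f z).toReal, (EReal.coe_toReal htop (hbot z)).symm⟩
  have hcont : Filter.Tendsto (fun t : ℝ => t • z + (1 - t) • y) (nhdsWithin 0 (Set.Ioi 0))
      (nhds y) := by
    have : Continuous (fun t : ℝ => t • z + (1 - t) • y) := by fun_prop
    have h2 := this.tendsto 0
    simp only [zero_smul, sub_zero, one_smul, zero_add] at h2
    exact h2.mono_left nhdsWithin_le_nhds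
  have h1 : ∀ᶠ t : ℝ in nhdsWithin 0 (Set.Ioi 0), t < 1 :=
    nhdsWithin_le_nhds (Iio_mem_nhds one_pos)
  obtain ⟨t, ⟨ht1, ht2⟩, ht0⟩ :=
    ((hcont.eventually hloc).and h1 |>.and self_mem_nhdsWithin).exists
  have ht0' : 0 < t := ht0
  have h3 := ht1.trans (hconv z y t ht0'.le ht2.le)
  rw [hr, hc] at h3
  have h4 : t • z + (1 - t) • y - y = t • (z - y) := by module
  rw [h4, norm_smul, Real.norm_of_nonneg ht0'.le] at h3
  have h5 : c - β * (t * ‖z - y‖) ≤ t * r + (1 - t) * c := by exact_mod_cast h3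
  rw [hr]
  have h6 : t * (c - β * ‖z - y‖) ≤ t * r := by linarith
  exact_mod_cast le_of_mul_le_mul_left h6 ht0'

/-- Subdifferential sum rule for `f + β‖· - y‖`, via Hahn-Banach. -/
theorem exists_subgrad_aux {X : Type*} [NormedAddCommGroup X] [NormedSpace ℝ X]
    (f : X → EReal) (hconv : EConvexOn f) (y : X) (c β : ℝ) (hβ : 0 ≤ β)
    (hc : f y = c) (hglob : ∀ z, ((c - β * ‖z - y‖ : ℝ) : EReal) ≤ f z) :
    ∃ g ∈ ESubdiff f y, ‖g‖ ≤ β := by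
  let s : Set (X × ℝ) := {p | p.2 + β * ‖p.1 - y‖ < c}
  let t : Set (X × ℝ) := {p | f p.1 ≤ (p.2 : EReal)}
  have hs2 : IsOpen s := isOpen_lt (by fun_prop) continuous_const
  have hs1 : Convex ℝ s := by
    rintro ⟨u, a⟩ hu ⟨v, b⟩ hv m n hm hn hmn
    simp only [s, Set.mem_ofPred_eq, Prod.fst_add, Prod.snd_add, Prod.smul_fst, Prod.smul_snd,
      smul_eq_mul] at *
    have e : m • u + n • v - y = m • (u - y) + n • (v - y) := by
      have : n = 1 - m := by linarith
      subst this; module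
    have h1 : ‖m • u + n • v - y‖ ≤ m * ‖u - y‖ + n * ‖v - y‖ := by
      rw [e]
      refine (norm_add_le _ _).trans ?_
      rw [norm_smul, norm_smul, Real.norm_of_nonneg hm, Real.norm_of_nonneg hn]
    have h2 := mul_le_mul_of_nonneg_left h1 hβ
    rcases hm.eq_or_lt with rfl | hm'
    · have : n = 1 := by linarith
      subst this; simpa using hv
    · have h3 := mul_lt_mul_of_pos_left hu hm'
      have h4 := mul_le_mul_of_nonneg_left hv.le hn
      have h5 : m * c + n * c = c := by rw [← add_mul, hmn, one_mul]
      nlinarith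
  have ht1 : Convex ℝ t := by
    rintro ⟨u, a⟩ hu ⟨v, b⟩ hv m n hm hn hmn
    simp only [t, Set.mem_ofPred_eq, Prod.fst_add, Prod.snd_add, Prod.smul_fst, Prod.smul_snd,
      smul_eq_mul] at *
    obtain rfl : n = 1 - m := by linarith
    refine (hconv u v m hm (by linarith)).trans ?_
    have h1 : (m : EReal) * f u ≤ (m : EReal) * a :=
      mul_le_mul_of_nonneg_left hu (by exact_mod_cast hm)
    have h2 : ((1 - m : ℝ) : EReal) * f v ≤ ((1 - m : ℝ) : EReal) * b :=
      mul_le_mul_of_nonneg_left hv (by exact_mod_cast hn)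
    refine (add_le_add h1 h2).trans ?_
    norm_cast
  have hdisj : Disjoint s t := by
    rw [Set.disjoint_left]
    rintro ⟨u, a⟩ hu hv
    simp only [s, t, Set.mem_ofPred_eq] at hu hv
    have : c - β * ‖u - y‖ ≤ a := by exact_mod_cast (hglob u).trans hv
    linarith
  obtain ⟨L, w, hL1, hL2⟩ := geometric_hahn_banach_open hs1 hs2 ht1 hdisj
  let l : X →L[ℝ] ℝ := L.comp (ContinuousLinearMap.inl ℝ X ℝ)
  let k : ℝ := L (0, 1)
  have hL : ∀ u a, L (u, a) = l u + a * k := by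
    intro u a
    have : ((u, a) : X × ℝ) = (u, 0) + a • (0, 1) := by simp
    rw [this, map_add, map_smul]; rfl
  have hA : ∀ u a, a + β * ‖u - y‖ < c → l u + a * k < w := fun u a h => by
    rw [← hL]; exact hL1 _ h
  have hB : ∀ u (a : ℝ), f u ≤ a → w ≤ l u + a * k := fun u a h => by
    rw [← hL]; exact hL2 _ h
  have hB0 := hB y c hc.le
  have hk : 0 < k := by
    have := hA y (c - 1) (by simp)
    linarith
  have hA' : ∀ u, l u + (c - β * ‖u - y‖) * k ≤ w := by
    intro u
    refine le_of_forall_pos_le_add fun e he => ?_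
    have h1 := hA u (c - β * ‖u - y‖ - e / k) (by
      have : 0 < e / k := by positivity
      linarith)
    have h2 : e / k * k = e := by field_simp
    nlinarith
  have hw : w = l y + c * k := by
    have := hA' y
    simp at this
    linarith
  refine ⟨-(k⁻¹ • l), ?_, ?_⟩
  · intro u
    rw [hc]
    by_cases htop : f u = ⊤
    · simp [htop]
    by_cases hb : f u = ⊥
    · exfalso
      have := hglob u
      rw [hb] at this
      exact EReal.coe_ne_bot _ (le_bot_iff.1 this)
    obtain ⟨r, hr⟩ : ∃ r : ℝ, f u = r := ⟨(f u).toReal, (EReal.coe_toReal htop hb).symm⟩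
    rw [hr]
    have h1 := hB u r hr.le
    rw [hw] at h1
    have : (-(k⁻¹ • l)) (u - y) ≤ r - c := by
      rw [neg_apply, smul_apply, smul_eq_mul, map_sub]
      have : k * (-(k⁻¹ * (l u - l y))) ≤ k * (r - c) := by
        have : k * (-(k⁻¹ * (l u - l y))) = -(l u - l y) := by field_simp
        rw [this]; linarith
      exact le_of_mul_le_mul_left this hk
    exact_mod_cast this
  · have hone : ∀ v, l v ≤ k * (β * ‖v‖) := by
      intro v
      have := hA' (y + v)
      simp only [map_add, add_sub_cancel_left] at this
      nlinarith
    refine ContinuousLinearMap.opNorm_le_bound _ hβ fun v => ?_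
    rw [neg_apply, norm_neg, smul_apply, norm_smul,
      Real.norm_of_nonneg (inv_nonneg.2 hk.le), inv_mul_le_iff₀ hk, Real.norm_eq_abs, abs_le]
    have h1 := hone v
    have h2 := hone (-v)
    rw [map_neg, norm_neg] at h2
    constructor <;> linarith

theorem toENN_eq_aux (a : EReal) : a.toENN = a.toENNReal := rfl

theorem error_bound_aux {X : Type*} [NormedAddCommGroup X] [NormedSpace ℝ X] [CompleteSpace X]
    (f : X → EReal) (hbot : ∀ u, f u ≠ ⊥) (hconv : EConvexOn f)
    (hlsc : LowerSemicontinuous f)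
    (xbar : X) (hxbar : f xbar ≤ 0) (τ α q : ℝ) (hα : 0 < α) (hατ : α < τ)
    (hq0 : 0 < q) (hq1 : q ≤ 1) (δ : ℝ) (ε : EReal)
    (H : ∀ y (b : ℝ), dist y xbar < δ → 0 < b → f y = b → f y < ε → ∀ g ∈ ESubdiff f y,
      τ ≤ q * b ^ (q - 1) * ‖g‖) (x : X) (hx : dist x xbar < δ / 2)
    (hxε : f x < ε) :
    ENNReal.ofReal α * Metric.infEDist x {v | f v ≤ 0} ≤ (f x).toENN ^ q := by
  by_contra hcon
  push Not at hcon
  let F : X → ℝ≥0∞ := fun z => (f z).toENNReal ^ q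
  have hF : LowerSemicontinuous F := by
    have hc : Continuous fun a : EReal => a.toENNReal ^ q :=
      ENNReal.continuous_rpow_const.comp EReal.continuous_toENNReal
    exact hc.comp_lowerSemicontinuous hlsc fun a b hab =>
      ENNReal.rpow_le_rpow (EReal.toENNReal_le_toENNReal hab) hq0.le
  have hA0 : ENNReal.ofReal α ≠ 0 := by simpa using hα
  have hcon' : F x < ENNReal.ofReal α * Metric.infEDist x {v | f v ≤ 0} := hcon
  obtain ⟨y, hy1, hy2⟩ := ekeland_aux F hF (ENNReal.ofReal α) hA0 ENNReal.ofReal_ne_top x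
    hcon'.ne_top
  have hd : edist x y < Metric.infEDist x {v | f v ≤ 0} := by
    have := (le_add_self.trans hy1).trans_lt hcon'
    exact lt_of_mul_lt_mul_left' this
  have hy0 : 0 < f y := by
    by_contra hn
    push Not at hn
    exact absurd (Metric.infEDist_le_edist_of_mem (x := x) (s := {v | f v ≤ 0}) hn) (not_le.2 hd)
  have hyx : f y ≤ f x := by
    have h1 : F y ≤ F x := le_self_add.trans hy1
    have h2 := (ENNReal.rpow_le_rpow_iff hq0).1 h1
    by_contra hn
    push Not at hn
    rcases le_total 0 (f x) with h0 | h0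
    · exact absurd (EReal.toENNReal_lt_toENNReal h0 hn) (not_lt.2 h2)
    · rw [EReal.toENNReal_of_nonpos h0] at h2
      exact absurd (EReal.toENNReal_pos_iff.2 hy0) (not_lt.2 h2)
  have hyε : f y < ε := hyx.trans_lt hxε
  obtain ⟨b, hb⟩ : ∃ b : ℝ, f y = b :=
    ⟨(f y).toReal, (EReal.coe_toReal hyε.ne_top (hbot y)).symm⟩
  have hb0 : 0 < b := by rw [hb] at hy0; exact_mod_cast hy0
  have hdy : dist y xbar < δ := by
    have h1 : edist x y < edist x xbar :=
      hd.trans_le (Metric.infEDist_le_edist_of_mem (s := {v | f v ≤ 0}) hxbar)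
    rw [edist_dist, edist_dist] at h1
    have h2 : dist x y < dist x xbar := (ENNReal.ofReal_lt_ofReal_iff_of_nonneg dist_nonneg).1 h1
    have h3 := dist_triangle y x xbar
    rw [dist_comm y x] at h3
    linarith
  set κ : ℝ := q * b ^ (q - 1) with hκ
  have hκ0 : 0 < κ := by positivity
  have hloc : ∀ᶠ z in nhds y, ((b - α / κ * ‖z - y‖ : ℝ) : EReal) ≤ f z := by
    filter_upwards [hlsc y 0 hy0] with z hz
    by_cases htop : f z = ⊤
    · simp [htop]
    obtain ⟨r, hr⟩ : ∃ r : ℝ, f z = r := ⟨(f z).toReal, (EReal.coe_toReal htop (hbot z)).symm⟩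
    have hr0 : 0 < r := by rw [hr] at hz; exact_mod_cast hz
    have h1 : F y ≤ F z + ENNReal.ofReal α * edist y z := by
      by_contra hn
      push Not at hn
      have := hy2 z hn.le
      subst this
      simp at hn
    simp only [F, hb, hr, EReal.real_coe_toENNReal] at h1
    rw [ENNReal.ofReal_rpow_of_pos hb0, ENNReal.ofReal_rpow_of_pos hr0, edist_dist,
      ← ENNReal.ofReal_mul hα.le, ← ENNReal.ofReal_add (by positivity) (by positivity),
      ENNReal.ofReal_le_ofReal_iff (by positivity), dist_comm, dist_eq_norm] at h1
    have h2 := rpow_tangent_aux hb0 hr0.le hq0.le hq1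
    rw [← hκ] at h2
    rw [hr]
    have h3 : κ * (b - α / κ * ‖z - y‖) ≤ κ * r := by
      have : κ * (b - α / κ * ‖z - y‖) = κ * b - α * ‖z - y‖ := by field_simp
      rw [this]; linarith
    exact_mod_cast le_of_mul_le_mul_left h3 hκ0
  obtain ⟨g, hg, hgn⟩ := exists_subgrad_aux f hconv y b (α / κ) (by positivity) hb
    (local_to_global_aux f hbot hconv y b _ hb hloc)
  have h1 := H y b hdy hb0 hb hyε g hg
  rw [← hκ] at h1
  have h2 : κ * ‖g‖ ≤ α := by
    rw [le_div_iff₀ hκ0] at hgn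
    linarith
  linarith

theorem ennreal_final_aux (q : ℝ) (hq0 : 0 < q) (hq1 : q ≤ 1) (a Q A d D : ℝ≥0∞)
    (ha0 : a ≠ 0) (ha : a ≠ ⊤) (hA0 : A ≠ 0) (hA : A ≠ ⊤)
    (h1 : A ≤ Q * a ^ (q - 1) * D) (h2 : A * d ≤ a ^ q) :
    A ≤ Q ^ q * d ^ (q - 1) * D ^ q := by
  have h3 : A ^ (1 - q) * (a ^ (q - 1)) ^ q ≤ d ^ (q - 1) := by
    have hd : d ≤ a ^ q * A⁻¹ := by
      rw [← div_eq_mul_inv, ENNReal.le_div_iff_mul_le (Or.inl hA0) (Or.inl hA), mul_comm]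
      exact h2
    have h4 : d ^ (1 - q) ≤ (a ^ q * A⁻¹) ^ (1 - q) := ENNReal.rpow_le_rpow hd (by linarith)
    have h5 := ENNReal.inv_le_inv.2 h4
    rw [← ENNReal.rpow_neg d, neg_sub] at h5
    refine le_trans (le_of_eq ?_) h5
    rw [ENNReal.mul_rpow_of_nonneg _ _ (by linarith : 0 ≤ 1 - q), ENNReal.mul_inv, 
      ENNReal.inv_rpow, inv_inv, ← ENNReal.rpow_mul, ← ENNReal.rpow_mul, ← ENNReal.rpow_neg, mul_comm]
    · congr 2; ring
    · left
      simp [← ENNReal.rpow_mul, ENNReal.rpow_eq_zero_iff, ha0, ha]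
    · left
      simp [← ENNReal.rpow_mul, ENNReal.rpow_eq_top_iff, ha0, ha]
  calc A = A ^ (1 - q) * A ^ q := by
        rw [← ENNReal.rpow_add _ _ hA0 hA]; simp
    _ ≤ A ^ (1 - q) * (Q * a ^ (q - 1) * D) ^ q := by gcongr
    _ = Q ^ q * (A ^ (1 - q) * (a ^ (q - 1)) ^ q) * D ^ q := by
        rw [ENNReal.mul_rpow_of_nonneg _ _ hq0.le, ENNReal.mul_rpow_of_nonneg _ _ hq0.le]; ring
    _ ≤ _ := by gcongr

/-- Corollary 3.18: for `f` convex lsc, `x̄ ∈ [f≤0]`, `q ∈ (0,1]`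
(convention `0⁰ = 1`), if `liminf_{x→x̄, f(x)↓0} q f(x)^{q−1} d(0,∂f(x)) ≥ τ > 0`
then `liminf_{x→x̄, f(x)↓0} q^q (1−q)^{1−q} d(x,[f≤0])^{q−1} d(0,∂f(x))^q ≥ (1−q)^{1−q} τ`,
i.e. `(1−q)^{1−q} Er̲_q f(x̄) ≤ Er̲'_q f(x̄)`. -/
theorem stmt_19 {X : Type*} [NormedAddCommGroup X] [NormedSpace ℝ X] [CompleteSpace X]
    (f : X → EReal) (hbot : ∀ u, f u ≠ ⊥) (hconv : EConvexOn f)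
    (hlsc : LowerSemicontinuous f)
    (xbar : X) (hxbar : f xbar ≤ 0) (τ q : ℝ) (hτ : 0 < τ)
    (hq0 : 0 < q) (hq1 : q ≤ 1)
    (h : ENNReal.ofReal τ ≤
      Filter.liminf
        (fun x => ENNReal.ofReal q * (f x).toENN ^ (q - 1) * dSub f x)
        (nhdsWithin xbar {x | 0 < f x} ⊓ Filter.comap f (nhds 0))) :
    ENNReal.ofReal ((1 - q) ^ (1 - q) * τ) ≤
      Filter.liminf
        (fun x => ENNReal.ofReal (q ^ q * (1 - q) ^ (1 - q)) *
          (EMetric.infEdist x {v | f v ≤ 0}) ^ (q - 1) * (dSub f x) ^ q)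
        (nhdsWithin xbar {x | 0 < f x} ⊓ Filter.comap f (nhds 0)) := by
  set K : ℝ := (1 - q) ^ (1 - q) with hK
  have hK0 : 0 < K := by
    rcases hq1.eq_or_lt with h1 | h1
    · simp [hK, h1]
    · exact Real.rpow_pos_of_pos (by linarith) _
  rw [Filter.le_liminf_iff']
  intro c hc
  obtain ⟨α, hα0, hατ, hcα⟩ : ∃ α : ℝ, 0 < α ∧ α < τ ∧ c ≤ ENNReal.ofReal (K * α) := by
    have hcR : c.toReal < K * τ := by
      have := (ENNReal.toReal_lt_toReal hc.ne_top ENNReal.ofReal_ne_top).2 hc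
      rwa [ENNReal.toReal_ofReal (by positivity)] at this
    have h1 : c.toReal / K < τ := by
      rw [div_lt_iff₀ hK0]; linarith
    obtain ⟨α, h2, h3⟩ := exists_between h1
    have h0 : 0 ≤ c.toReal / K := by positivity
    refine ⟨α, h0.trans_lt h2, h3, ?_⟩
    rw [← ENNReal.ofReal_toReal hc.ne_top]
    apply ENNReal.ofReal_le_ofReal
    rw [div_lt_iff₀ hK0] at h2
    linarith
  obtain ⟨α', hα', hα'τ⟩ := exists_between hατ
  have hev := Filter.eventually_lt_of_lt_liminf
    (((ENNReal.ofReal_lt_ofReal_iff hτ).2 hα'τ).trans_le h)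
  obtain ⟨s, hs, t, ht, hst⟩ := Filter.mem_inf_iff_superset.1 hev
  obtain ⟨δ, hδ, hδs⟩ := Metric.mem_nhdsWithin_iff.1 hs
  obtain ⟨u, hu, hut⟩ := Filter.mem_comap.1 ht
  obtain ⟨ε, hε, hεu⟩ := exists_Ico_subset_of_mem_nhds hu ⟨(1 : EReal), zero_lt_one⟩
  have P : ∀ y, dist y xbar < δ → 0 < f y → f y < ε →
      ENNReal.ofReal α' < ENNReal.ofReal q * (f y).toENN ^ (q - 1) * dSub f y :=
    fun y h1 h2 h3 => hst ⟨hδs ⟨h1, h2⟩, hut (hεu ⟨h2.le, h3⟩)⟩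
  have H : ∀ y (b : ℝ), dist y xbar < δ → 0 < b → f y = b → f y < ε → ∀ g ∈ ESubdiff f y,
      α' ≤ q * b ^ (q - 1) * ‖g‖ := by
    intro y b h1 hb hyb h3 g hg
    have h4 := P y h1 (by rw [hyb]; exact_mod_cast hb) h3
    have h5 : dSub f y ≤ ENNReal.ofReal ‖g‖ := iInf₂_le g hg
    have h6 := h4.le.trans (mul_le_mul_right h5 _)
    rw [toENN_eq_aux, hyb, EReal.real_coe_toENNReal, ENNReal.ofReal_rpow_of_pos hb,
      ← ENNReal.ofReal_mul hq0.le, ← ENNReal.ofReal_mul (by positivity),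
      ENNReal.ofReal_le_ofReal_iff (by positivity)] at h6
    exact h6
  have E1 : ∀ᶠ x in nhdsWithin xbar {x | 0 < f x} ⊓ Filter.comap f (nhds 0),
      dist x xbar < δ / 2 ∧ 0 < f x := by
    apply Filter.Eventually.filter_mono inf_le_left
    have : ∀ᶠ x in nhdsWithin xbar {x | 0 < f x}, dist x xbar < δ / 2 :=
      nhdsWithin_le_nhds (Metric.ball_mem_nhds xbar (by positivity))
    exact this.and self_mem_nhdsWithin
  have E2 : ∀ᶠ x in nhdsWithin xbar {x | 0 < f x} ⊓ Filter.comap f (nhds 0), f x < ε := by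
    apply Filter.Eventually.filter_mono inf_le_right
    exact Filter.tendsto_comap.eventually (Iio_mem_nhds hε)
  filter_upwards [E1, E2] with x hx1 hx2
  obtain ⟨hxd, hx0⟩ := hx1
  have hEB := error_bound_aux f hbot hconv hlsc xbar hxbar α' α q hα0 hα' hq0 hq1 δ ε H x hxd hx2
  have hP := (P x (by linarith) hx0 hx2).le
  have hfin := ennreal_final_aux q hq0 hq1 (f x).toENN (ENNReal.ofReal q) (ENNReal.ofReal α)
    (Metric.infEDist x {v | f v ≤ 0}) (dSub f x) (EReal.toENNReal_ne_zero_iff.2 hx0)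
    (EReal.toENNReal_ne_top_iff.2 hx2.ne_top) (by simpa using hα0) ENNReal.ofReal_ne_top
    ((ENNReal.ofReal_le_ofReal hα'.le).trans hP) hEB
  refine hcα.trans ?_
  rw [ENNReal.ofReal_mul hK0.le, mul_comm (q ^ q) K, ENNReal.ofReal_mul hK0.le, mul_assoc, mul_assoc]
  refine mul_le_mul_right ?_ _
  rw [← ENNReal.ofReal_rpow_of_pos hq0, ← mul_assoc]
  exact hfin
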